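/- The growth operator 𝔑 and the pruning operator 𝔓 are adjoint with respect to the inner product on k{T}: for all x, y ∈ k{T}, (𝔑(x), y) = (x, 𝔓(y)). -/

import Mathlib

attribute [local instance] Classical.propDecidable

inductive PlanarTree : Type where
  | node : List PlanarTree → PlanarTree

namespace PlanarTree

/-- Isomorphism of (planar representatives of) rooted trees: the lists of
principal branches match up, pairwise isomorphically, after a permutation. -/
inductive Iso : PlanarTree → PlanarTree → Prop where
  | node {l m l' : List PlanarTree} :
      List.Perm l m → List.Forall₂ Iso m l' → Iso (node l) (node l')

/-- Number of vertices. -/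
def size : PlanarTree → ℕ
  | node l => 1 + (l.attach.map fun c => size c.1).sum
decreasing_by simp only [PlanarTree.node.sizeOf_spec]; exact Nat.lt_of_lt_of_le (List.sizeOf_lt_of_mem c.2) (Nat.le_add_left _ _)

mutual
  /-- All trees obtained by attaching the root of `s` by a new edge to some vertex. -/
  def graftList (s : PlanarTree) : PlanarTree → List PlanarTree
    | node l => node (s :: l) :: (graftAux s l).map node
  def graftAux (s : PlanarTree) : List PlanarTree → List (List PlanarTree)
    | [] => []
    | a :: l => ((graftList s a).map (· :: l)) ++ (graftAux s l).map (a :: ·)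
end

/-- All trees obtained by adding a new edge and terminal vertex at some vertex. -/
def growList (t : PlanarTree) : List PlanarTree := graftList (node []) t

mutual
  /-- All trees obtained by deleting one (non-root) terminal vertex. -/
  def pruneList : PlanarTree → List PlanarTree
    | node l => (pruneAux l).map node
  def pruneAux : List PlanarTree → List (List PlanarTree)
    | [] => []
    | a :: l =>
        (match a with | node [] => [l] | _ => []) ++
        ((pruneList a).map (· :: l)) ++ (pruneAux l).map (a :: ·)
end

mutual
  /-- All pairs (cut-off subtree, remaining tree) obtained by cutting one edge. -/
  def cutPairs : PlanarTree → List (PlanarTree × PlanarTree)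
    | node l => (cutAux l).map fun x => (x.1, node x.2)
  def cutAux : List PlanarTree → List (PlanarTree × List PlanarTree)
    | [] => []
    | a :: l =>
        (a, l) :: (((cutPairs a).map fun x => (x.1, x.2 :: l)) ++
          (cutAux l).map fun x => (x.1, a :: x.2))
end

/-- The order of the symmetry group `SG(t)`: the product over all vertices `v`
of the number of permutations of the branches at `v` exchanging isomorphic branches. -/
noncomputable def sg : PlanarTree → ℕ
  | node l =>
      (l.attach.map fun c => sg c.1).prod *
        Nat.card {σ : Equiv.Perm (Fin l.length) // ∀ i, Iso (l.get (σ i)) (l.get i)}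
decreasing_by simp only [PlanarTree.node.sizeOf_spec]; exact Nat.lt_of_lt_of_le (List.sizeOf_lt_of_mem c.2) (Nat.le_add_left _ _)

/-- Vertices of a planar tree, encoded as paths of child-indices from the root. -/
inductive IsVertex : PlanarTree → List ℕ → Prop where
  | root (t : PlanarTree) : IsVertex t []
  | child {l : List PlanarTree} {i : ℕ} {c : PlanarTree} {p : List ℕ} :
      l[i]? = some c → IsVertex c p → IsVertex (node l) (i :: p)

def Vertex (t : PlanarTree) : Type := {p : List ℕ // IsVertex t p}

/-- `v` lies strictly below `w` in the tree order (i.e. `w` is a proper ancestor of `v`). -/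
def StrictBelow {t : PlanarTree} (v w : Vertex t) : Prop := w.1 <+: v.1 ∧ w.1 ≠ v.1

/-- A labelling of `t`. -/
def Labelling (t : PlanarTree) : Type :=
  {f : Vertex t ≃ Fin t.size // ∀ v w, StrictBelow v w → f w < f v}

/-- Equivalence of labellings: they differ by an automorphism of the rooted tree. -/
def labelEquiv {t : PlanarTree} (f g : Labelling t) : Prop :=
  ∃ φ : Equiv.Perm (Vertex t),
    (∀ v w, StrictBelow (φ v) (φ w) ↔ StrictBelow v w) ∧ ∀ v, f.1 (φ v) = g.1 v

end PlanarTree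

/-- Rooted trees: isomorphism classes of planar rooted trees. -/
instance planarSetoid : Setoid PlanarTree := Relation.EqvGen.setoid PlanarTree.Iso

def RTree : Type := Quotient planarSetoid

namespace RTree

def mk (p : PlanarTree) : RTree := ⟦p⟧

/-- A chosen planar representative. -/
noncomputable def rep (T : RTree) : PlanarTree := Quotient.out T

noncomputable def size (T : RTree) : ℕ := T.rep.size

/-- The order of the symmetry (automorphism) group of `T`. -/
noncomputable def sg (T : RTree) : ℕ := T.rep.sg

/-- The one-vertex tree. -/
def bullet : RTree := mk (PlanarTree.node [])

/-- `Covers T T'` means `T ⊲ T'`: `T` is obtained from `T'` by deleting one terminal vertex. -/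
noncomputable def Covers (T T' : RTree) : Prop :=
  ∃ p ∈ T'.rep.pruneList, mk p = T

/-- `n(T;T')`: the number of vertices of `T` to which a new edge can be added to obtain `T'`. -/
noncomputable def nCov (T T' : RTree) : ℕ :=
  T.rep.growList.countP fun p => decide (mk p = T')

/-- `m(T;T')`: the number of (terminal) edges of `T'` which when removed leave `T`. -/
noncomputable def mCov (T T' : RTree) : ℕ :=
  T'.rep.pruneList.countP fun p => decide (mk p = T)

/-- `n(T₁,T₂;T₃)`: the number of vertices of `T₂` such that attaching the root of `T₁`
there by a new edge yields `T₃`. -/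
noncomputable def nTri (T₁ T₂ T₃ : RTree) : ℕ :=
  (PlanarTree.graftList T₁.rep T₂.rep).countP fun p => decide (mk p = T₃)

/-- `m(T₁,T₂;T₃)`: the number of edges of `T₃` whose removal cuts off a subtree
isomorphic to `T₁` leaving `T₂` (the piece containing the root). -/
noncomputable def mTri (T₁ T₂ T₃ : RTree) : ℕ :=
  T₃.rep.cutPairs.countP fun x => decide (mk x.1 = T₁ ∧ mk x.2 = T₂)

end RTree

section Ops

variable (k : Type*) [Semiring k]

/-- The element `𝔑(T) = Σ_{T ⊲ T'} n(T;T')·T'` of `k{T}`. -/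
noncomputable def growF (T : RTree) : RTree →₀ k :=
  (T.rep.growList.map fun p => Finsupp.single (RTree.mk p) (1 : k)).sum

/-- The element `𝔓(T) = Σ_{T' ⊲ T} m(T';T)·T'` of `k{T}`. -/
noncomputable def pruneF (T : RTree) : RTree →₀ k :=
  (T.rep.pruneList.map fun p => Finsupp.single (RTree.mk p) (1 : k)).sum

/-- The growth operator `𝔑` on `k{T}`. -/
noncomputable def Grow : Module.End k (RTree →₀ k) :=
  Finsupp.linearCombination k (growF k)

/-- The pruning operator `𝔓` on `k{T}`. -/
noncomputable def Prune : Module.End k (RTree →₀ k) :=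
  Finsupp.linearCombination k (pruneF k)

/-- The operator `𝔇` on `k{T}`, `𝔇(t) = |t|·t`. -/
noncomputable def Diag : Module.End k (RTree →₀ k) :=
  Finsupp.linearCombination k fun T => (T.size : k) • Finsupp.single T 1

/-- The inner product on `k{T}` determined by `(t,t') = |SG(t)|·δ_{t,t'}`. -/
noncomputable def innerT (x y : RTree →₀ k) : k :=
  x.sum fun T c => c * y T * (T.sg : k)

/-- Generalized multiplicity `n(T;T')`: coefficient of `T'` in `𝔑^{|T'|-|T|}(T)`. -/
noncomputable def nGen (T T' : RTree) : k :=
  ((Grow k ^ (T'.size - T.size)) (Finsupp.single T 1)) T'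

/-- Generalized multiplicity `m(T;T')`: coefficient of `T` in `𝔓^{|T'|-|T|}(T')`. -/
noncomputable def mGen (T T' : RTree) : k :=
  ((Prune k ^ (T'.size - T.size)) (Finsupp.single T' 1)) T

end Ops

section Kreimer

variable (k : Type*) [CommSemiring k]

/-- Kreimer's Hopf algebra `H_K`, as a commutative algebra: the free polynomial
algebra on rooted trees. -/
abbrev HK := MvPolynomial RTree k

/-- The inclusion `k{T} → H_K` of the linear span of the variables. -/
noncomputable def toHK : (RTree →₀ k) →ₗ[k] HK k :=
  Finsupp.linearCombination k fun T => MvPolynomial.X T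

/-- The growth derivation `N` on `H_K`, with `N(t) = 𝔑(t)` for rooted trees `t`. -/
noncomputable def ND : Derivation k (HK k) (HK k) :=
  MvPolynomial.mkDerivation k fun T => toHK k (growF k T)

/-- The pruning derivation `P` on `H_K`, with `P(t) = 𝔓(t)` for `|t| ≥ 2`, `P(•) = 1`. -/
noncomputable def PD : Derivation k (HK k) (HK k) :=
  MvPolynomial.mkDerivation k fun T =>
    if T = RTree.bullet then 1 else toHK k (pruneF k T)

/-- The grading derivation `D` on `H_K`, multiplying each homogeneous element of
degree `n` by `n`; it is the derivation with `D(t) = |t|·t` for rooted trees `t`. -/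
noncomputable def DD : Derivation k (HK k) (HK k) :=
  MvPolynomial.mkDerivation k fun T => (T.size : k) • MvPolynomial.X T

/-- The map `B₊ : H_K → k{T}` sending a forest to the tree obtained by attaching
all its roots to a new root vertex. -/
noncomputable def forestTree (d : RTree →₀ ℕ) : RTree :=
  RTree.mk (PlanarTree.node
    (d.support.toList.flatMap fun T => List.replicate (d T) T.rep))

noncomputable def Bplus (p : HK k) : RTree →₀ k :=
  ∑ d ∈ p.support, Finsupp.single (forestTree d) (MvPolynomial.coeff d p)

/-- The inner product on `H_K`. -/
noncomputable def innerHK (u v : HK k) : k := innerT k (Bplus k u) (Bplus k v)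

/-- The degree-`n` homogeneous component of `H_K`. -/
noncomputable abbrev HKcomp (n : ℕ) : Submodule k (HK k) :=
  MvPolynomial.weightedHomogeneousSubmodule k (fun T : RTree => T.size) n

/-- `T_i`: the number of rooted trees with `i+1` vertices. -/
noncomputable def Tcard (i : ℕ) : ℕ := Nat.card {T : RTree // T.size = i + 1}

end Kreimer

namespace PlanarTree

theorem induction_branches {C : PlanarTree → Prop}
    (h : ∀ l, (∀ a ∈ l, C a) → C (node l)) : ∀ t, C t
  | node l => h l fun a _ => induction_branches h a
decreasing_by
  simp only [PlanarTree.node.sizeOf_spec]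
  exact Nat.lt_of_lt_of_le (List.sizeOf_lt_of_mem ‹_›) (Nat.le_add_left _ _)

theorem Iso.induction {R : PlanarTree → PlanarTree → Prop}
    (h : ∀ {l m l'}, List.Perm l m → List.Forall₂ R m l' →
      R (PlanarTree.node l) (PlanarTree.node l'))
    {p q : PlanarTree} (hpq : Iso p q) : R p q :=
  Iso.rec (motive_1 := fun p q _ => R p q) (motive_2 := fun l m _ => List.Forall₂ R l m)
    (fun hlm _ ih => h hlm ih) .nil (fun _ _ h₁ h₂ => .cons h₁ h₂) hpq

theorem Iso.refl (p : PlanarTree) : Iso p p := by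
  induction p using induction_branches with
  | h l ih => exact .node (.refl _) (List.forall₂_same.2 ih)

theorem Iso.symm {p q : PlanarTree} (h : Iso p q) : Iso q p := by
  refine Iso.induction (R := fun p q => Iso q p) ?_ h
  intro l m l' hlm hml
  obtain ⟨m', h₁, h₂⟩ : Relation.Comp List.Perm (List.Forall₂ Iso) l' l := by
    rw [← List.forall₂_comp_perm_eq_perm_comp_forall₂]
    exact ⟨m, hml.flip, hlm.symm⟩
  exact .node h₁ h₂

theorem Iso.trans {p q r : PlanarTree} (h : Iso p q) (h' : Iso q r) : Iso p r := by
  revert r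
  refine Iso.induction (R := fun p q => ∀ {r}, Iso q r → Iso p r) ?_ h
  rintro l m l' hlm hml _ ⟨hl', hr⟩
  rename_i m' r
  obtain ⟨n, h₁, h₂⟩ : Relation.Comp List.Perm
      (List.Forall₂ fun p q => ∀ {r}, Iso q r → Iso p r) m m' := by
    rw [← List.forall₂_comp_perm_eq_perm_comp_forall₂]
    exact ⟨l', hml, hl'⟩
  refine .node (hlm.trans h₁) ?_
  clear hl' hlm hml h₁
  induction h₂ generalizing r with
  | nil => cases hr; exact .nil
  | cons h _ ih => cases hr with | cons h' ht => exact .cons (h h') (ih ht)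

theorem mk_eq_mk_iff {p q : PlanarTree} : RTree.mk p = RTree.mk q ↔ Iso p q := by
  refine ⟨fun h => ?_, fun h => Quotient.sound (.rel _ _ h)⟩
  exact (Equivalence.eqvGen_iff ⟨Iso.refl, Iso.symm, Iso.trans⟩).1 (Quotient.exact h)

/-- The multiset of isomorphism classes of a list of planar trees. -/
def forest (l : List PlanarTree) : Multiset RTree := ↑(l.map RTree.mk)

@[simp] theorem forest_nil : forest [] = 0 := rfl

@[simp] theorem forest_cons (a : PlanarTree) (l : List PlanarTree) :
    forest (a :: l) = RTree.mk a ::ₘ forest l := rfl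

theorem forest_eq_of_perm {l m : List PlanarTree} (h : l.Perm m) : forest l = forest m :=
  Multiset.coe_eq_coe.2 (h.map _)

theorem forest_eq_of_forall₂ {R : PlanarTree → PlanarTree → Prop}
    (hR : ∀ {p q}, R p q → RTree.mk p = RTree.mk q) {l m : List PlanarTree}
    (h : List.Forall₂ R l m) : forest l = forest m := by
  induction h with
  | nil => rfl
  | cons h _ ih => simp [hR h, ih]

theorem mk_node_eq_iff {l l' : List PlanarTree} :
    RTree.mk (node l) = RTree.mk (node l') ↔ forest l = forest l' := by
  rw [mk_eq_mk_iff]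
  constructor
  · rintro ⟨h₁, h₂⟩
    exact (forest_eq_of_perm h₁).trans (forest_eq_of_forall₂ mk_eq_mk_iff.2 h₂)
  · intro h
    obtain ⟨m, h₁, h₂⟩ : Relation.Comp List.Perm
        (List.Forall₂ fun p T => RTree.mk p = T) l (l'.map RTree.mk) := by
      rw [← List.forall₂_comp_perm_eq_perm_comp_forall₂]
      refine ⟨l.map RTree.mk, ?_, Multiset.coe_eq_coe.1 h⟩
      rw [List.forall₂_map_right_iff]
      exact List.forall₂_same.2 fun _ _ => rfl
    rw [List.forall₂_map_right_iff] at h₂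
    exact .node h₁ (h₂.imp fun _ _ => mk_eq_mk_iff.1)

/-- Insert the forests `E a`, for each single member `a` of a list, in place of `a`. -/
noncomputable def substOne (E : PlanarTree → Multiset (Multiset RTree)) :
    List PlanarTree → Multiset (Multiset RTree)
  | [] => 0
  | a :: l => (E a).map (· + forest l) + (substOne E l).map (RTree.mk a ::ₘ ·)

theorem substOne_eq_of_perm (E : PlanarTree → Multiset (Multiset RTree))
    {l m : List PlanarTree} (h : l.Perm m) : substOne E l = substOne E m := by
  induction h with
  | nil => rfl
  | cons a h ih => simp [substOne, ih, forest_eq_of_perm h]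
  | swap a b l =>
    simp only [substOne, Multiset.map_add, Multiset.map_map, Function.comp_def, forest_cons,
      Multiset.add_cons, Multiset.cons_swap (RTree.mk a) (RTree.mk b)]
    exact add_left_comm _ _ _
  | trans _ _ ih₁ ih₂ => exact ih₁.trans ih₂

theorem substOne_eq_of_forall₂ {E : PlanarTree → Multiset (Multiset RTree)}
    {l m : List PlanarTree}
    (h : List.Forall₂ (fun p q => RTree.mk p = RTree.mk q ∧ E p = E q) l m) :
    substOne E l = substOne E m := by
  induction h with
  | nil => rfl
  | cons h ht ih => simp [substOne, ih, h.1, h.2, forest_eq_of_forall₂ (And.left ·) ht]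

theorem substOne_comp_mk (E : RTree → Multiset (Multiset RTree)) (l : List PlanarTree) :
    substOne (fun a => E (RTree.mk a)) l =
      (forest l).bind fun T => (E T).map (· + (forest l).erase T) := by
  induction l with
  | nil => rfl
  | cons a l ih =>
    simp only [substOne, forest_cons, Multiset.cons_bind, Multiset.erase_cons_head, ih,
      Multiset.map_bind, Multiset.map_map, Function.comp_def]
    congr 1
    refine Multiset.bind_congr fun T hT => Multiset.map_congr rfl fun x _ => ?_
    by_cases h : RTree.mk a = T
    · subst h
      rw [Multiset.erase_cons_head, ← Multiset.add_cons, Multiset.cons_erase hT]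
    · rw [Multiset.erase_cons_tail _ h, Multiset.add_cons]

/-- The isomorphism classes obtained from a tree by adding a terminal vertex. -/
noncomputable def growths (p : PlanarTree) : Multiset RTree := ↑(p.growList.map RTree.mk)

/-- The isomorphism classes obtained from a tree by deleting a terminal vertex. -/
noncomputable def prunings (p : PlanarTree) : Multiset RTree := ↑(p.pruneList.map RTree.mk)

end PlanarTree

namespace RTree

open PlanarTree (forest substOne growths prunings mk_node_eq_iff mk_eq_mk_iff)

theorem mk_rep (T : RTree) : mk T.rep = T := Quotient.out_eq T

/-- The tree whose principal branches are the members of a forest. -/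
noncomputable def graftRoot (f : Multiset RTree) : RTree :=
  mk (PlanarTree.node (f.toList.map rep))

theorem mk_node (l : List PlanarTree) : mk (PlanarTree.node l) = graftRoot (forest l) := by
  rw [graftRoot, mk_node_eq_iff]
  simp [forest, Function.comp_def, mk_rep]

theorem graftRoot_injective : Function.Injective graftRoot := by
  intro f g h
  rw [graftRoot, graftRoot, mk_node_eq_iff] at h
  simpa [forest, Function.comp_def, mk_rep] using h

theorem graftRoot_zero : graftRoot 0 = bullet := (mk_node []).symm

theorem mk_eq_bullet_iff {l : List PlanarTree} : mk (PlanarTree.node l) = bullet ↔ l = [] := by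
  rw [bullet, mk_node_eq_iff]
  cases l <;> simp

theorem coe_map_graftAux (l : List PlanarTree) :
    (↑((PlanarTree.graftAux (.node []) l).map forest) : Multiset (Multiset RTree)) =
      substOne (fun a => (growths a).map ({·})) l := by
  induction l with
  | nil => rfl
  | cons a l ih =>
    rw [substOne, ← ih]
    simp [PlanarTree.graftAux, growths, PlanarTree.growList, Function.comp_def]

theorem growths_node (l : List PlanarTree) :
    growths (.node l) =
      ((bullet ::ₘ forest l) ::ₘ substOne (fun a => (growths a).map ({·})) l).map graftRoot := by
  rw [← coe_map_graftAux]
  simp [growths, PlanarTree.growList, PlanarTree.graftList, Function.comp_def, mk_node,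
    graftRoot_zero]

/-- The forests which can replace a branch when a terminal vertex of it is deleted. -/
noncomputable def pruneForests (T : RTree) (M : Multiset RTree) : Multiset (Multiset RTree) :=
  (if T = bullet then {0} else 0) + M.map ({·})

theorem coe_map_pruneAux (l : List PlanarTree) :
    (↑((PlanarTree.pruneAux l).map forest) : Multiset (Multiset RTree)) =
      substOne (fun a => pruneForests (mk a) (prunings a)) l := by
  induction l with
  | nil => rfl
  | cons a l ih =>
    rw [substOne, ← ih]
    obtain ⟨_ | ⟨b, m⟩⟩ := a
    · simp [PlanarTree.pruneAux, prunings, pruneForests, mk_eq_bullet_iff, Function.comp_def]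
    · simp [PlanarTree.pruneAux, prunings, pruneForests, mk_eq_bullet_iff, Function.comp_def]

theorem prunings_node (l : List PlanarTree) :
    prunings (.node l) =
      (substOne (fun a => pruneForests (mk a) (prunings a)) l).map graftRoot := by
  rw [← coe_map_pruneAux]
  simp [prunings, PlanarTree.pruneList, Function.comp_def, mk_node]

theorem growths_rep_mk (p : PlanarTree) : growths (mk p).rep = growths p := by
  refine (PlanarTree.Iso.induction
    (R := fun p q => mk p = mk q ∧ growths p = growths q) ?_
    (mk_eq_mk_iff.1 (mk_rep (mk p)))).2
  intro l m l' hlm hml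
  have hf := (PlanarTree.forest_eq_of_perm hlm).trans
    (PlanarTree.forest_eq_of_forall₂ (And.left ·) hml)
  refine ⟨mk_node_eq_iff.2 hf, ?_⟩
  rw [growths_node, growths_node, hf, PlanarTree.substOne_eq_of_perm _ hlm,
    PlanarTree.substOne_eq_of_forall₂ (hml.imp fun _ _ h => ⟨h.1, by rw [h.2]⟩)]

theorem prunings_rep_mk (p : PlanarTree) : prunings (mk p).rep = prunings p := by
  refine (PlanarTree.Iso.induction
    (R := fun p q => mk p = mk q ∧ prunings p = prunings q) ?_
    (mk_eq_mk_iff.1 (mk_rep (mk p)))).2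
  intro l m l' hlm hml
  have hf := (PlanarTree.forest_eq_of_perm hlm).trans
    (PlanarTree.forest_eq_of_forall₂ (And.left ·) hml)
  refine ⟨mk_node_eq_iff.2 hf, ?_⟩
  rw [prunings_node, prunings_node, PlanarTree.substOne_eq_of_perm _ hlm,
    PlanarTree.substOne_eq_of_forall₂ (hml.imp fun _ _ h => ⟨h.1, by rw [h.1, h.2]⟩)]

theorem growths_graftRoot (f : Multiset RTree) :
    growths (graftRoot f).rep = ((bullet ::ₘ f) ::ₘ f.bind fun T =>
      (growths T.rep).map (· ::ₘ f.erase T)).map graftRoot := by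
  obtain ⟨l, rfl⟩ : ∃ l, forest l = f :=
    ⟨f.toList.map rep, by simp [forest, Function.comp_def, mk_rep]⟩
  have h := PlanarTree.substOne_comp_mk (fun T => (growths T.rep).map ({·})) l
  simp only [growths_rep_mk] at h
  rw [← mk_node, growths_rep_mk, growths_node, h]
  simp [Function.comp_def]

theorem prunings_graftRoot (f : Multiset RTree) :
    prunings (graftRoot f).rep = (f.bind fun T =>
      (if T = bullet then {f.erase T} else 0) +
        (prunings T.rep).map (· ::ₘ f.erase T)).map graftRoot := by
  obtain ⟨l, rfl⟩ : ∃ l, forest l = f :=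
    ⟨f.toList.map rep, by simp [forest, Function.comp_def, mk_rep]⟩
  have h := PlanarTree.substOne_comp_mk (fun T => pruneForests T (prunings T.rep)) l
  simp only [prunings_rep_mk] at h
  rw [← mk_node, prunings_rep_mk, prunings_node, h]
  congr 1
  refine Multiset.bind_congr fun T _ => ?_
  rw [pruneForests]
  split_ifs <;> simp [Function.comp_def]

/-- The order of the symmetry group of a forest. -/
noncomputable def forestSg (f : Multiset RTree) : ℕ :=
  (f.map sg).prod * ∏ T ∈ f.toFinset, (f.count T).factorial

theorem sg_node (l : List PlanarTree) :
    (PlanarTree.node l).sg = (l.map PlanarTree.sg).prod *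
      ∏ T ∈ (forest l).toFinset, ((forest l).count T).factorial := by
  rw [PlanarTree.sg]
  congr 1
  · simp
  have hl : forest l = Finset.univ.val.map fun i => mk (l.get i) := by
    rw [Fin.univ_val_map, forest]
    exact congrArg _ (by rw [← Function.comp_def mk, ← List.map_ofFn, List.ofFn_get])
  have h := DomMulAct.stabilizer_card' fun i => mk (l.get i)
  simp only [funext_iff, Function.comp_apply, mk_eq_mk_iff] at h
  rw [Nat.card_eq_fintype_card, h, hl]
  refine Finset.prod_congr rfl fun T _ => ?_
  rw [Multiset.count_map, Fintype.card_subtype]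
  simp only [eq_comm]
  rfl

theorem sg_mk (p : PlanarTree) : (mk p).sg = p.sg := by
  refine (PlanarTree.Iso.induction
    (R := fun p q => mk p = mk q ∧ p.sg = q.sg) ?_
    (mk_eq_mk_iff.1 (mk_rep (mk p)))).2
  intro l m l' hlm hml
  have hf := (PlanarTree.forest_eq_of_perm hlm).trans
    (PlanarTree.forest_eq_of_forall₂ (And.left ·) hml)
  refine ⟨mk_node_eq_iff.2 hf, ?_⟩
  rw [sg_node, sg_node, hf, (hlm.map _).prod_eq]
  congr 2
  clear hlm hf
  induction hml with
  | nil => rfl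
  | cons h _ ih => simp [h.2, ih]

theorem sg_graftRoot (f : Multiset RTree) : (graftRoot f).sg = forestSg f := by
  obtain ⟨l, rfl⟩ : ∃ l, forest l = f :=
    ⟨f.toList.map rep, by simp [forest, Function.comp_def, mk_rep]⟩
  rw [← mk_node, sg_mk, sg_node, forestSg]
  simp [forest, Function.comp_def, sg_mk]

theorem sg_bullet : bullet.sg = 1 := by
  simp [← graftRoot_zero, sg_graftRoot, forestSg]

theorem forestSg_cons (T : RTree) (f : Multiset RTree) :
    forestSg (T ::ₘ f) = T.sg * (f.count T + 1) * forestSg f := by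
  have h : ∏ S ∈ f.toFinset, (f.count S).factorial =
      ∏ S ∈ insert T f.toFinset, (f.count S).factorial := by
    refine Finset.prod_subset (Finset.subset_insert _ _) fun S _ hS => ?_
    rw [Multiset.count_eq_zero_of_notMem (mt Multiset.mem_toFinset.2 hS), Nat.factorial_zero]
  have h' (S : RTree) : ((T ::ₘ f).count S).factorial =
      (if S = T then f.count S + 1 else 1) * (f.count S).factorial := by
    rw [Multiset.count_cons]
    split_ifs <;> simp [Nat.factorial_succ]
  rw [forestSg, forestSg, h, Multiset.toFinset_cons, Multiset.map_cons, Multiset.prod_cons]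
  simp only [h', Finset.prod_mul_distrib, Finset.prod_ite_eq', Finset.mem_insert_self, if_true]
  ring

theorem forestSg_eq {T : RTree} {f : Multiset RTree} (h : T ∈ f) :
    forestSg f = T.sg * f.count T * forestSg (f.erase T) := by
  conv_lhs => rw [← Multiset.cons_erase h, forestSg_cons]
  rw [Multiset.count_erase_self, Nat.sub_add_cancel (Multiset.count_pos.2 h)]

theorem eq_cons_iff {T : RTree} {f g : Multiset RTree} :
    g = T ::ₘ f ↔ T ∈ g ∧ f = g.erase T := by
  constructor
  · rintro rfl
    simp
  · rintro ⟨h, rfl⟩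
    exact (Multiset.cons_erase h).symm

theorem count_map_cons (M h g : Multiset RTree) :
    (M.map (· ::ₘ h)).count g =
      ∑ T ∈ g.toFinset, if h = g.erase T then M.count T else 0 := by
  induction M using Multiset.induction with
  | empty => simp
  | cons S M ih =>
    have h' (T : RTree) : (if h = g.erase T then (S ::ₘ M).count T else 0) =
        (if h = g.erase T then M.count T else 0) +
          if T = S then if h = g.erase T then 1 else 0 else 0 := by
      rw [Multiset.count_cons]
      split_ifs <;> rfl
    rw [Finset.sum_congr rfl fun T _ => h' T, Finset.sum_add_distrib, Finset.sum_ite_eq', ← ih,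
      Multiset.map_cons, Multiset.count_cons]
    simp only [Multiset.mem_toFinset, ← ite_and, ← eq_cons_iff]

theorem count_growths_graftRoot (f g : Multiset RTree) :
    (growths (graftRoot f).rep).count (graftRoot g) =
      (if g = bullet ::ₘ f then 1 else 0) + ∑ S ∈ f.toFinset, ∑ T ∈ g.toFinset,
        if f.erase S = g.erase T then f.count S * (growths S.rep).count T else 0 := by
  rw [growths_graftRoot, Multiset.count_map_eq_count' _ _ graftRoot_injective,
    Multiset.count_cons, Multiset.count_bind, Finset.sum_multiset_map_count, add_comm]
  simp only [count_map_cons, smul_eq_mul, Finset.mul_sum, mul_ite, mul_zero]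

theorem count_prunings_graftRoot (f g : Multiset RTree) :
    (prunings (graftRoot g).rep).count (graftRoot f) =
      (if g = bullet ::ₘ f then g.count bullet else 0) + ∑ S ∈ f.toFinset, ∑ T ∈ g.toFinset,
        if f.erase S = g.erase T then g.count T * (prunings T.rep).count S else 0 := by
  have h (T : RTree) :
      (if T = bullet then {g.erase T} else 0 : Multiset (Multiset RTree)).count f =
        if T = bullet then if f = g.erase T then 1 else 0 else 0 := by
    split_ifs <;> simp_all
  rw [prunings_graftRoot, Multiset.count_map_eq_count' _ _ graftRoot_injective,
    Multiset.count_bind, Finset.sum_multiset_map_count, Finset.sum_comm]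
  simp only [Multiset.count_add, count_map_cons, smul_eq_mul, mul_add, Finset.sum_add_distrib,
    Finset.mul_sum, mul_ite, mul_zero, mul_one, h, Finset.sum_ite_eq', Multiset.mem_toFinset,
    eq_comm (a := Multiset.erase g _)]
  simp only [← ite_and, ← eq_cons_iff]

theorem count_growths_mul_sg (S T : RTree) :
    (growths S.rep).count T * T.sg = (prunings T.rep).count S * S.sg := by
  obtain ⟨p, rfl⟩ : ∃ p, mk p = S := ⟨_, mk_rep S⟩
  induction p using PlanarTree.induction_branches generalizing T with
  | h l ih =>
  obtain ⟨g, rfl⟩ : ∃ g, graftRoot g = T := by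
    obtain ⟨⟨m⟩, rfl⟩ : ∃ p, mk p = T := ⟨_, mk_rep T⟩
    exact ⟨_, (mk_node m).symm⟩
  rw [mk_node, count_growths_graftRoot, count_prunings_graftRoot, sg_graftRoot, sg_graftRoot,
    add_mul, add_mul, Finset.sum_mul, Finset.sum_mul]
  congr 1
  · split_ifs with h
    · subst h
      rw [forestSg_cons, sg_bullet, Multiset.count_cons_self]
      ring
    · simp
  refine Finset.sum_congr rfl fun S hS => ?_
  rw [Finset.sum_mul, Finset.sum_mul]
  refine Finset.sum_congr rfl fun T hT => ?_
  split_ifs with h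
  · rw [Multiset.mem_toFinset] at hS hT
    obtain ⟨a, ha, rfl⟩ : ∃ a ∈ l, mk a = S := by simpa [forest] using hS
    rw [forestSg_eq hS, forestSg_eq hT, h]
    linear_combination (forest l).count (mk a) * g.count T * forestSg (g.erase T) * ih a ha T
  · simp

end RTree

theorem sum_map_single_apply (k : Type*) [Semiring k] (l : List PlanarTree) (T : RTree) :
    (l.map fun p => Finsupp.single (RTree.mk p) (1 : k)).sum T =
      ((↑(l.map RTree.mk) : Multiset RTree).count T : k) := by
  induction l with
  | nil => simp
  | cons a l ih =>
    rw [List.map_cons, List.sum_cons, Finsupp.add_apply, ih, List.map_cons, ← Multiset.cons_coe,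
      Multiset.count_cons, Finsupp.single_apply]
    simp [add_comm, eq_comm]

/-- `𝔑` and `𝔓` are adjoint for the inner product on `k{T}`. -/
theorem stmt2 (k : Type*) [Field k] [CharZero k] (x y : RTree →₀ k) :
    innerT k (Grow k x) y = innerT k x (Prune k y) := by
  have zero_left (y) : innerT k 0 y = 0 := Finsupp.sum_zero_index
  have zero_right (x) : innerT k x 0 = 0 := by simp [innerT]
  have add_left (x x' y) : innerT k (x + x') y = innerT k x y + innerT k x' y :=
    Finsupp.sum_add_index' (by simp) (by intros; ring)
  have add_right (x y y') : innerT k x (y + y') = innerT k x y + innerT k x y' := by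
    simp only [innerT, Finsupp.add_apply, mul_add, add_mul, Finsupp.sum_add]
  have single_left (S c y) : innerT k (Finsupp.single S c) y = c * y S * (S.sg : k) :=
    Finsupp.sum_single_index (by simp)
  have single_right (x T c) : innerT k x (Finsupp.single T c) = x T * c * (T.sg : k) := by
    induction x using Finsupp.induction_linear with
    | zero => simp [zero_left]
    | add x x' h h' => rw [add_left, h, h', Finsupp.add_apply]; ring
    | single S d =>
      rw [single_left]
      by_cases h : T = S
      · simp [h]
      · simp [h, Ne.symm h]
  induction x using Finsupp.induction_linear with
  | zero => simp [zero_left]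
  | add x x' h h' => rw [map_add, add_left, add_left, h, h']
  | single S c =>
  induction y using Finsupp.induction_linear with
  | zero => simp [zero_right]
  | add y y' h h' => rw [map_add, add_right, add_right, h, h']
  | single T d =>
  rw [single_right, single_left, Grow, Prune, Finsupp.linearCombination_single,
    Finsupp.linearCombination_single, Finsupp.smul_apply, Finsupp.smul_apply, growF, pruneF,
    sum_map_single_apply, sum_map_single_apply, smul_eq_mul, smul_eq_mul]
  have h : ((PlanarTree.growths S.rep).count T : k) * T.sg =
      (PlanarTree.prunings T.rep).count S * S.sg := mod_cast RTree.count_growths_mul_sg S T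
  rw [PlanarTree.growths, PlanarTree.prunings] at h
  linear_combination c * d * h
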